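/- The compactly supported top de Rham cohomology of ℝ^n is one-dimensional: the integration map induces an isomorphism H^n_c(ℝ^n) ≅ ℝ, and a compactly supported n-form is exact (equal to dη with η compactly supported) if and only if its integral over ℝ^n vanishes. -/

import Mathlib

open MeasureTheory

theorem aux_param {E : Type} [NormedAddCommGroup E] [NormedSpace ℝ E] [FiniteDimensional ℝ E]
    (a b : ℝ) (n : ℕ) : ∀ {F : Type} [NormedAddCommGroup F] [NormedSpace ℝ F]
    (Φ : E × ℝ → F), ContDiff ℝ (⊤ : ℕ∞) Φ →
    ContDiff ℝ n (fun x => ∫ u in a..b, Φ (x, u)) := by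
  have : ProperSpace E := FiniteDimensional.proper ℝ E
  induction n with
  | zero =>
    intro F _ _ Φ hΦ
    refine contDiff_zero.2 ?_
    exact intervalIntegral.continuous_parametric_intervalIntegral_of_continuous'
      (f := fun x u => Φ (x, u)) (by simpa [Function.uncurry_def] using hΦ.continuous) a b
  | succ n ih =>
    intro F _ _ Φ hΦ
    have hc := hΦ.continuous
    let Ψ : E × ℝ → (E →L[ℝ] F) := fun p => (fderiv ℝ Φ p).comp (ContinuousLinearMap.inl ℝ E ℝ)
    have hΨ : ContDiff ℝ (⊤ : ℕ∞) Ψ := by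
      have h1 : ContDiff ℝ (⊤ : ℕ∞) (fderiv ℝ Φ) := hΦ.fderiv_right (by simp)
      exact h1.clm_comp contDiff_const
    have hΨc := hΨ.continuous
    have key : ∀ x t, HasFDerivAt (fun y => Φ (y, t)) (Ψ (x, t)) x := by
      intro x t
      have h1 : HasFDerivAt Φ (fderiv ℝ Φ (x, t)) (x, t) :=
        (hΦ.differentiable (by simp)).differentiableAt.hasFDerivAt
      exact h1.comp x (hasFDerivAt_prodMk_left x t)
    push_cast
    refine contDiff_succ_iff_hasFDerivAt.2 ⟨fun x => ∫ u in a..b, Ψ (x, u), ih Ψ hΨ, ?_⟩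
    intro x
    obtain ⟨M, hM⟩ := ((isCompact_closedBall x 1).prod (isCompact_uIcc (a := a) (b := b))).bddAbove_image
      hΨc.norm.continuousOn
    refine intervalIntegral.hasFDerivAt_integral_of_dominated_of_fderiv_le
      (F := fun x u => Φ (x, u)) (F' := fun x u => Ψ (x, u)) (bound := fun _ => M)
      (Metric.closedBall_mem_nhds x one_pos) ?_ ?_ ?_ ?_ ?_ ?_
    · exact Filter.Eventually.of_forall fun y =>
        (hc.comp (by fun_prop : Continuous fun u : ℝ => (y, u))).aestronglyMeasurable
    · exact (hc.comp (by fun_prop : Continuous fun u : ℝ => (x, u))).intervalIntegrable _ _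
    · exact (hΨc.comp (by fun_prop : Continuous fun u : ℝ => (x, u))).aestronglyMeasurable
    · refine Filter.Eventually.of_forall fun t ht y hy => hM ?_
      exact ⟨(y, t), ⟨hy, Set.uIoc_subset_uIcc ht⟩, rfl⟩
    · exact intervalIntegrable_const
    · exact Filter.Eventually.of_forall fun t _ y _ => key y t

theorem aux_param_smooth {E : Type} [NormedAddCommGroup E] [NormedSpace ℝ E]
    [FiniteDimensional ℝ E] (a b : ℝ) (Φ : E × ℝ → ℝ) (h : ContDiff ℝ (⊤ : ℕ∞) Φ) :
    ContDiff ℝ (⊤ : ℕ∞) (fun x => ∫ u in a..b, Φ (x, u)) :=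
  contDiff_infty.2 fun n => aux_param a b n Φ h

theorem aux_update {n : ℕ} {E : Type} [NormedAddCommGroup E] [NormedSpace ℝ E] (i : Fin n)
    {p : E → (Fin n → ℝ)} {q : E → ℝ} (hp : ContDiff ℝ (⊤ : ℕ∞) p) (hq : ContDiff ℝ (⊤ : ℕ∞) q) :
    ContDiff ℝ (⊤ : ℕ∞) (fun e => Function.update (p e) i (q e)) := by
  refine contDiff_pi.2 fun j => ?_
  by_cases hj : j = i
  · subst hj; simpa using hq
  · simpa [Function.update_of_ne hj] using contDiff_pi.1 hp j

theorem aux_int_zero {n : ℕ} (g : (Fin n → ℝ) → ℝ) (hg : ContDiff ℝ (⊤ : ℕ∞) g)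
    (hs : HasCompactSupport g) (v : Fin n → ℝ) :
    Integrable (fun x => fderiv ℝ g x v) ∧ ∫ x, fderiv ℝ g x v = 0 := by
  have h1 : Integrable (fun x => fderiv ℝ g x v) := by
    refine Continuous.integrable_of_hasCompactSupport ?_ (hs.fderiv_apply ℝ v)
    exact (hg.continuous_fderiv (by simp)).clm_apply continuous_const
  refine ⟨h1, ?_⟩
  have := integral_mul_fderiv_eq_neg_fderiv_mul_of_integrable (μ := volume)
    (f := fun _ : Fin n → ℝ => (1 : ℝ)) (g := g) (v := v) (by simp) (by simpa using h1)
    (by simpa using hg.continuous.integrable_of_hasCompactSupport hs)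
    (fun x _ => by fun_prop) (fun x _ => (hg.differentiable (by simp)).differentiableAt)
  simpa using this

theorem aux_bdd {n : ℕ} {f : (Fin n → ℝ) → ℝ} (hs : HasCompactSupport f) :
    ∃ R : ℝ, 0 < R ∧ ∀ x, (∃ j, R ≤ |x j|) → f x = 0 := by
  obtain ⟨R, hR, h⟩ := hs.isCompact.isBounded.exists_pos_norm_le
  refine ⟨R + 1, by linarith, fun x ⟨j, hj⟩ => ?_⟩
  by_contra hx
  have := h x (subset_tsupport _ hx)
  have h2 := norm_le_pi_norm x j
  rw [Real.norm_eq_abs] at h2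
  linarith

theorem aux_cpt {n : ℕ} {f : (Fin n → ℝ) → ℝ} (R : ℝ) (h : ∀ x, (∃ j, R ≤ |x j|) → f x = 0)
    (hR : 0 < R) : HasCompactSupport f := by
  refine HasCompactSupport.intro (isCompact_closedBall 0 R) fun x hx => h x ?_
  by_contra! hc
  apply hx
  rw [mem_closedBall_zero_iff, pi_norm_le_iff_of_nonneg hR.le]
  exact fun j => (hc j).le

theorem aux_step {n : ℕ} (i : Fin n) (φ : ℝ → ℝ) (hφ : ContDiff ℝ (⊤ : ℕ∞) φ)
    (hφs : ∀ t, 1 ≤ |t| → φ t = 0) (hφi : ∫ t, φ t = 1)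
    (F : (Fin n → ℝ) → ℝ) (hF : ContDiff ℝ (⊤ : ℕ∞) F) (hFs : HasCompactSupport F) :
    ∃ (R : ℝ) (g : (Fin n → ℝ) → ℝ), ContDiff ℝ (⊤ : ℕ∞) g ∧ HasCompactSupport g ∧
      ContDiff ℝ (⊤ : ℕ∞) (fun x => φ (x i) * ∫ r in (-R)..R, F (Function.update x i r)) ∧
      HasCompactSupport (fun x => φ (x i) * ∫ r in (-R)..R, F (Function.update x i r)) ∧
      ∀ x, F x = fderiv ℝ g x (Pi.single i 1) +
        φ (x i) * ∫ r in (-R)..R, F (Function.update x i r) := by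
  obtain ⟨R₀, hR₀, hR₀F⟩ := aux_bdd hFs
  obtain ⟨R, hR1, hRR⟩ : ∃ R : ℝ, 1 ≤ R ∧ R₀ ≤ R := ⟨max 1 R₀, le_max_left _ _, le_max_right _ _⟩
  have hR : 0 < R := by linarith
  have hRF : ∀ x, (∃ j, R ≤ |x j|) → F x = 0 := fun x ⟨j, hj⟩ => hR₀F x ⟨j, hRR.trans hj⟩
  have hRφ : ∀ t, R ≤ |t| → φ t = 0 := fun t ht => hφs t (hR1.trans ht)
  let J : (Fin n → ℝ) → ℝ := fun x => ∫ r in (-R)..R, F (Function.update x i r)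
  have hJ : ContDiff ℝ (⊤ : ℕ∞) J :=
    aux_param_smooth (-R) R (fun p : (Fin n → ℝ) × ℝ => F (Function.update p.1 i p.2))
      (hF.comp (aux_update i contDiff_fst contDiff_snd))
  have hJu : ∀ x t, J (Function.update x i t) = J x := by
    intro x t; simp [J]
  let F' : (Fin n → ℝ) → ℝ := fun x => φ (x i) * J x
  have hF' : ContDiff ℝ (⊤ : ℕ∞) F' := (hφ.comp (contDiff_apply ℝ ℝ i)).mul hJ
  have hF'0 : ∀ x, (∃ j, R ≤ |x j|) → F' x = 0 := by
    rintro x ⟨j, hj⟩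
    by_cases hji : j = i
    · subst hji; simp [F', hRφ _ hj]
    · have : J x = 0 := by
        simp only [J]
        rw [intervalIntegral.integral_congr (g := fun _ => (0 : ℝ))]
        · simp
        · intro r _
          exact hRF _ ⟨j, by simpa [Function.update_of_ne hji] using hj⟩
      simp [F', this]
  let K : (Fin n → ℝ) → ℝ := fun x => F x - F' x
  have hK : ContDiff ℝ (⊤ : ℕ∞) K := hF.sub hF'
  have hK0 : ∀ x, (∃ j, R ≤ |x j|) → K x = 0 := fun x hx => by simp [K, hRF x hx, hF'0 x hx]
  have hKc : ∀ x, Continuous fun s : ℝ => K (Function.update x i s) := fun x =>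
    hK.continuous.comp (aux_update i (contDiff_const (c := x)) contDiff_id).continuous
  have hφI : ∫ t in (-R)..R, φ t = 1 := by
    rw [← hφi]
    apply intervalIntegral.integral_eq_integral_of_support_subset
    intro t ht
    have : |t| < R := by
      by_contra! h
      exact ht (hRφ t h)
    rw [abs_lt] at this
    exact ⟨this.1, this.2.le⟩
  have hKI : ∀ x, ∫ s in (-R)..R, K (Function.update x i s) = 0 := by
    intro x
    have h1 : Continuous fun s : ℝ => F (Function.update x i s) :=
      hF.continuous.comp (aux_update i (contDiff_const (c := x)) contDiff_id).continuous
    have hφc := hφ.continuous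
    have h2 : ∀ s : ℝ, K (Function.update x i s) = F (Function.update x i s) - φ s * J x := by
      intro s
      simp only [K, F', hJu, Function.update_self]
    simp only [h2]
    rw [intervalIntegral.integral_sub (h1.intervalIntegrable _ _)
      ((by fun_prop : Continuous fun s : ℝ => φ s * J x).intervalIntegrable _ _),
      intervalIntegral.integral_mul_const, hφI]
    simp [J]
  let g : (Fin n → ℝ) → ℝ := fun x => ∫ s in (-R)..(x i), K (Function.update x i s)
  have hgeq : g = fun x => ∫ u in (0:ℝ)..1,
      (x i + R) * K (Function.update x i ((x i + R) * u + (-R))) := by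
    funext x
    rw [intervalIntegral.integral_const_mul]
    rw [intervalIntegral.mul_integral_comp_mul_add (f := fun s => K (Function.update x i s))]
    simp [g]
  have hg : ContDiff ℝ (⊤ : ℕ∞) g := by
    rw [hgeq]
    have hxi : ContDiff ℝ (⊤ : ℕ∞) (fun p : (Fin n → ℝ) × ℝ => p.1 i + R) :=
      ((contDiff_apply ℝ ℝ i).comp contDiff_fst).add contDiff_const
    refine aux_param_smooth 0 1 (fun p : (Fin n → ℝ) × ℝ =>
      (p.1 i + R) * K (Function.update p.1 i ((p.1 i + R) * p.2 + (-R)))) ?_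
    exact hxi.mul (hK.comp (aux_update i contDiff_fst
      ((hxi.mul contDiff_snd).add contDiff_const)))
  have hg0 : ∀ x, (∃ j, R ≤ |x j|) → g x = 0 := by
    rintro x ⟨j, hj⟩
    have hz : ∀ a b : ℝ, (∀ s ∈ Set.uIcc a b, K (Function.update x i s) = 0) →
        ∫ s in a..b, K (Function.update x i s) = 0 := by
      intro a b h
      rw [intervalIntegral.integral_congr (g := fun _ => (0 : ℝ)) h]
      simp
    by_cases hji : j = i
    · subst hji
      rcases le_abs.1 hj with h | h
      · have := intervalIntegral.integral_add_adjacent_intervals (μ := volume)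
          ((hKc x).intervalIntegrable (-R) R) ((hKc x).intervalIntegrable R (x j))
        simp only [g]
        rw [← this, hKI, hz, add_zero]
        intro s hs
        rw [Set.uIcc_of_le h] at hs
        exact hK0 _ ⟨j, by simpa using hs.1.trans (le_abs_self s)⟩
      · apply hz
        intro s hs
        rw [Set.uIcc_of_ge (by linarith)] at hs
        refine hK0 _ ⟨j, ?_⟩
        have := neg_le_abs s
        simp only [Function.update_self]
        linarith [hs.2]
    · apply hz
      intro s _
      exact hK0 _ ⟨j, by simpa [Function.update_of_ne hji] using hj⟩
  refine ⟨R, g, hg, aux_cpt R hg0 hR, hF', aux_cpt R hF'0 hR, fun x => ?_⟩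
  have hd : DifferentiableAt ℝ g x := (hg.differentiable (by simp)).differentiableAt
  have hl : HasLineDerivAt ℝ g (K x) x (Pi.single i 1) := by
    have e : (fun t : ℝ => g (x + t • Pi.single i (1:ℝ))) =
        fun t => ∫ s in (-R)..(x i + t), K (Function.update x i s) := by
      funext t
      have h1 : ∀ s, Function.update (x + t • Pi.single i (1:ℝ)) i s = Function.update x i s := by
        intro s
        funext j
        by_cases hj : j = i
        · subst hj; simp
        · simp [hj]
      simp only [g, h1]
      simp
    unfold HasLineDerivAt
    rw [e]
    have h2 : HasDerivAt (fun u => ∫ s in (-R)..u, K (Function.update x i s))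
        (K (Function.update x i (x i))) (x i + 0) := by
      rw [add_zero]
      exact intervalIntegral.integral_hasDerivAt_right ((hKc x).intervalIntegrable _ _)
        ((hKc x).stronglyMeasurableAtFilter _ _) (hKc x).continuousAt
    rw [Function.update_eq_self] at h2
    exact h2.comp_const_add (x i) 0
  have := hl.lineDeriv
  rw [hd.lineDeriv_eq_fderiv] at this
  rw [this]
  simp [K, F', J]

theorem aux_bump : ∃ φ : ℝ → ℝ, ContDiff ℝ (⊤ : ℕ∞) φ ∧ (∀ t, 1 ≤ |t| → φ t = 0) ∧
    ∫ t, φ t = 1 ∧ φ 0 ≠ 0 := by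
  let b : ContDiffBump (0 : ℝ) := ⟨1/2, 1, by norm_num, by norm_num⟩
  refine ⟨b.normed volume, b.contDiff_normed, fun t ht => ?_, b.integral_normed, ?_⟩
  · have := b.support_normed_eq (μ := volume)
    by_contra h
    have h2 : t ∈ Function.support (b.normed volume) := h
    rw [this] at h2
    simp [b] at h2
    linarith
  · have := b.support_normed_eq (μ := volume)
    have h2 : (0:ℝ) ∈ Function.support (b.normed volume) := by
      rw [this]; simp [b]
    exact h2

theorem aux_decomp {n : ℕ} (φ : ℝ → ℝ) (hφ : ContDiff ℝ (⊤ : ℕ∞) φ)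
    (hφs : ∀ t, 1 ≤ |t| → φ t = 0) (hφi : ∫ t, φ t = 1)
    (f : (Fin n → ℝ) → ℝ) (hf : ContDiff ℝ (⊤ : ℕ∞) f) (hfs : HasCompactSupport f)
    (s : Finset (Fin n)) :
    ∃ (F : (Fin n → ℝ) → ℝ) (g : Fin n → (Fin n → ℝ) → ℝ),
      ContDiff ℝ (⊤ : ℕ∞) F ∧ HasCompactSupport F ∧
      (∀ i, ContDiff ℝ (⊤ : ℕ∞) (g i)) ∧ (∀ i, HasCompactSupport (g i)) ∧
      (∀ x, f x = ∑ i ∈ s, fderiv ℝ (g i) x (Pi.single i 1) + F x) ∧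
      ∀ i ∈ s, ∀ x t, F (Function.update x i t) * φ (x i) = F x * φ t := by
  induction s using Finset.induction_on with
  | empty =>
    exact ⟨f, fun _ _ => 0, hf, hfs, fun _ => contDiff_const, fun _ => HasCompactSupport.zero,
      by simp, by simp⟩
  | insert i s his ih =>
    obtain ⟨F, g, hF, hFs, hg, hgs, he, hinv⟩ := ih
    obtain ⟨R, G, hG, hGs, hF', hFs', hE⟩ := aux_step i φ hφ hφs hφi F hF hFs
    refine ⟨_, Function.update g i G, hF', hFs', ?_, ?_, ?_, ?_⟩
    · intro j
      by_cases hj : j = i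
      · subst hj; simpa using hG
      · simpa [Function.update_of_ne hj] using hg j
    · intro j
      by_cases hj : j = i
      · subst hj; simpa using hGs
      · simpa [Function.update_of_ne hj] using hgs j
    · intro x
      rw [he x, hE x, Finset.sum_insert his, Function.update_self]
      have : ∑ j ∈ s, fderiv ℝ (Function.update g i G j) x (Pi.single j 1) =
          ∑ j ∈ s, fderiv ℝ (g j) x (Pi.single j 1) := by
        refine Finset.sum_congr rfl fun j hj => ?_
        have hji : j ≠ i := fun h => his (h ▸ hj)
        rw [Function.update_of_ne hji]
      rw [this]
      ring
    · intro j hj x t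
      rcases Finset.mem_insert.1 hj with rfl | hj
      · simp only [Function.update_self, Function.update_idem]
        ring
      · have hji : j ≠ i := fun h => his (h ▸ hj)
        simp only [Function.update_of_ne hji.symm]
        rw [mul_assoc, mul_assoc, ← intervalIntegral.integral_mul_const,
          ← intervalIntegral.integral_mul_const]
        congr 1
        refine intervalIntegral.integral_congr fun r _ => ?_
        have := hinv j hj (Function.update x i r) t
        rw [Function.update_of_ne hji] at this
        rw [Function.update_comm hji, this]

theorem aux_prod {n : ℕ} (φ : ℝ → ℝ) (F : (Fin n → ℝ) → ℝ)
    (h : ∀ i, ∀ x t, F (Function.update x i t) * φ (x i) = F x * φ t)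
    (x y : Fin n → ℝ) (s : Finset (Fin n)) :
    F (s.piecewise y x) * ∏ i ∈ s, φ (x i) = F x * ∏ i ∈ s, φ (y i) := by
  induction s using Finset.induction_on with
  | empty => simp
  | insert i s his ih =>
    rw [Finset.piecewise_insert, Finset.prod_insert his, Finset.prod_insert his]
    have := h i (s.piecewise y x) (y i)
    rw [Finset.piecewise_eq_of_notMem _ _ _ his] at this
    linear_combination (∏ i ∈ s, φ (x i)) * this + φ (y i) * ih

/-- The compactly supported top de Rham cohomology of `ℝⁿ` is one-dimensional:
identifying compactly supported `n`-forms `f dx₁∧…∧dxₙ` with their (smooth, compactly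
supported) coefficient functions `f`, a compactly supported `n`-form is exact — i.e.
`f = ∑ᵢ ∂ᵢ gᵢ` for smooth compactly supported `gᵢ` (the coefficients of a compactly
supported `(n-1)`-form `η` with `dη = f dx₁∧…∧dxₙ`) — if and only if `∫ f = 0`;
and the integration map `Hⁿ_c(ℝⁿ) → ℝ` is surjective, hence an isomorphism. -/
theorem stmt18 (n : ℕ) :
    (∀ f : (Fin n → ℝ) → ℝ, ContDiff ℝ (⊤ : ℕ∞) f → HasCompactSupport f →
      ((∃ g : Fin n → (Fin n → ℝ) → ℝ,
          (∀ i, ContDiff ℝ (⊤ : ℕ∞) (g i)) ∧ (∀ i, HasCompactSupport (g i)) ∧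
          ∀ x, f x = ∑ i, fderiv ℝ (g i) x (Pi.single i 1)) ↔
        ∫ x : Fin n → ℝ, f x = 0)) ∧
    (∀ c : ℝ, ∃ f : (Fin n → ℝ) → ℝ,
      ContDiff ℝ (⊤ : ℕ∞) f ∧ HasCompactSupport f ∧ ∫ x : Fin n → ℝ, f x = c) := by
  obtain ⟨φ, hφ, hφs, hφi, hφ0⟩ := aux_bump
  have hP : ContDiff ℝ (⊤ : ℕ∞) (fun x : Fin n → ℝ => ∏ i, φ (x i)) :=
    contDiff_prod fun i _ => hφ.comp (contDiff_apply ℝ ℝ i)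
  have hPs : HasCompactSupport (fun x : Fin n → ℝ => ∏ i, φ (x i)) :=
    aux_cpt 1 (fun x ⟨j, hj⟩ => Finset.prod_eq_zero (Finset.mem_univ j) (hφs _ hj)) one_pos
  have hPi : ∫ x : Fin n → ℝ, ∏ i, φ (x i) = 1 := by
    rw [integral_fintype_prod_volume_eq_pow, hφi, one_pow]
  have hsum : ∀ g : Fin n → (Fin n → ℝ) → ℝ, (∀ i, ContDiff ℝ (⊤ : ℕ∞) (g i)) →
      (∀ i, HasCompactSupport (g i)) →
      ∫ x, ∑ i, fderiv ℝ (g i) x (Pi.single i 1) = 0 := by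
    intro g hg hgs
    rw [integral_finsetSum _ fun i _ => (aux_int_zero (g i) (hg i) (hgs i) _).1]
    exact Finset.sum_eq_zero fun i _ => (aux_int_zero (g i) (hg i) (hgs i) _).2
  refine ⟨fun f hf hfs => ⟨?_, fun h0 => ?_⟩, fun c => ?_⟩
  · rintro ⟨g, hg, hgs, he⟩
    simp only [he]
    exact hsum g hg hgs
  · obtain ⟨F, g, hF, hFs, hg, hgs, he, hinv⟩ := aux_decomp φ hφ hφs hφi f hf hfs Finset.univ
    have hFi : ∫ x, F x = 0 := by
      have h1 : ∫ x, f x = ∫ x, (∑ i, fderiv ℝ (g i) x (Pi.single i 1) + F x) :=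
        integral_congr_ae (Filter.Eventually.of_forall he)
      rw [integral_add (integrable_finsetSum _
        fun i _ => (aux_int_zero (g i) (hg i) (hgs i) _).1)
        (hF.continuous.integrable_of_hasCompactSupport hFs), hsum g hg hgs, h0] at h1
      linarith
    have hprod : ∀ x, F 0 * ∏ i, φ (x i) = F x * ∏ _i : Fin n, φ 0 := by
      intro x
      have := aux_prod φ F (fun i => hinv i (Finset.mem_univ i)) x 0 Finset.univ
      simpa using this
    have hc : F 0 = 0 := by
      have h2 : ∫ x : Fin n → ℝ, F 0 * ∏ i, φ (x i) = ∫ x, F x * ∏ _i : Fin n, φ 0 := by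
        simp only [hprod]
      rw [integral_const_mul, integral_mul_const, hPi, hFi] at h2
      linarith
    have hF0 : ∀ x, F x = 0 := by
      intro x
      have h3 := hprod x
      rw [hc, zero_mul] at h3
      exact (mul_eq_zero.1 h3.symm).resolve_right (Finset.prod_ne_zero_iff.2 fun _ _ => hφ0)
    exact ⟨g, hg, hgs, fun x => by rw [he x, hF0 x, add_zero]⟩
  · refine ⟨fun x => c * ∏ i, φ (x i), contDiff_const.mul hP, hPs.mul_left, ?_⟩
    rw [integral_const_mul, hPi, mul_one]
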